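/- arXiv:0912.3894 — 2 statements merged into one kernel-verified Lean document; each statement's English description precedes it below -/
import Mathlib

section
/- Let 0 < a < π√3/4, let Δ = Δ_hex(a) be the hexagonal lattice ℤ·(2a,0) + ℤ·(a, a√3), let H(Δ) be the closed Voronoi cell of 0, let c > 0, and let D = H(Δ) × [0, c] ⊂ ℝ³ (a closed convex hexagonal prism). Let P : ℝ³ → D be the nearest-point (metric) projection onto D, which is well defined and 1-Lipschitz since D is closed and convex. Then for every piecewise C¹ curve γ : [0,1] → ℝ³ one has L_Δ(P ∘ γ) ≤ L_Δ(γ), where the length of the Lipschitz curve P ∘ γ is computed using its almost-everywhere derivative. -/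
open Real MeasureTheory Set

noncomputable section

/-- The point `(x, y)` of the Euclidean plane. -/
def pt2 (x y : ℝ) : EuclideanSpace ℝ (Fin 2) := (WithLp.equiv 2 (Fin 2 → ℝ)).symm ![x, y]

/-- `f : [0,1] → ℝ` is piecewise `C¹`. -/
def PC1 (f : ℝ → ℝ) : Prop :=
  ∃ (n : ℕ) (t : ℕ → ℝ), t 0 = 0 ∧ t n = 1 ∧ (∀ i < n, t i < t (i + 1)) ∧
    ContinuousOn f (Set.Icc 0 1) ∧ ∀ i < n, ContDiffOn ℝ 1 f (Set.Icc (t i) (t (i + 1)))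

/-- Length of a (Lipschitz) curve `γ : [0,1] → ℝ³` for the singular metric
`h = dx² + dy² + cos²(dist((x,y),Δ)) dz²`, computed with the (a.e. defined) derivative. -/
def sLen3 (Δ : Set (EuclideanSpace ℝ (Fin 2))) (γ : ℝ → EuclideanSpace ℝ (Fin 3)) : ℝ :=
  ∫ t in (0:ℝ)..1, Real.sqrt ((deriv (fun s => γ s 0) t) ^ 2 + (deriv (fun s => γ s 1) t) ^ 2 +
    Real.cos (Metric.infDist (pt2 (γ t 0) (γ t 1)) Δ) ^ 2 * (deriv (fun s => γ s 2) t) ^ 2)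

/-- The hexagonal lattice `Δ_hex(a) = ℤ·(2a,0) + ℤ·(a, a√3) ⊂ ℝ²`. -/
def ΔhexE (a : ℝ) : Set (EuclideanSpace ℝ (Fin 2)) :=
  {p | ∃ m n : ℤ, p = pt2 (2 * a * m + a * n) (a * Real.sqrt 3 * n)}

/-- The closed Voronoi cell of `0` of a planar lattice `Δ`. -/
def vorCell (Δ : Set (EuclideanSpace ℝ (Fin 2))) : Set (EuclideanSpace ℝ (Fin 2)) :=
  {p | ∀ q ∈ Δ, ‖p‖ ≤ ‖p - q‖}

lemma pt2_sub (x y u v : ℝ) : pt2 x y - pt2 u v = pt2 (x - u) (y - v) := by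
  ext i; fin_cases i <;> simp [pt2]

lemma norm_pt2 (x y : ℝ) : ‖pt2 x y‖ = √(x ^ 2 + y ^ 2) := by
  simp [EuclideanSpace.norm_eq, pt2]

lemma continuous_pt2 : Continuous fun p : ℝ × ℝ => pt2 p.1 p.2 := by
  refine (PiLp.continuous_toLp 2 _).comp (continuous_pi fun i => ?_)
  fin_cases i
  · exact continuous_fst
  · exact continuous_snd

/-- The hexagon cut out by the three strips orthogonal to the shortest vectors of `ΔhexE a`. -/
def InHexagon (a x y : ℝ) : Prop :=
  |x| ≤ a ∧ |x + √3 * y| ≤ 2 * a ∧ |x - √3 * y| ≤ 2 * a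

/-- The integer inequality saying that only the six shortest vectors of the hexagonal lattice
bound its Voronoi cell. -/
lemma int_linear_le_hexagonal_form {l k : ℝ} (hl : |l| ≤ 1) (hk : |k| ≤ 1) (hlk : |l - k| ≤ 1)
    (m n : ℤ) : m * l + n * k ≤ (m : ℝ) ^ 2 + m * n + n ^ 2 := by
  rw [abs_le] at hl hk hlk
  obtain ⟨hl1, hl2⟩ := hl
  obtain ⟨hk1, hk2⟩ := hk
  obtain ⟨h1, h2⟩ := hlk
  have sq : ∀ j : ℤ, (j : ℝ) ≤ (j : ℝ) ^ 2 := fun j => by exact_mod_cast Int.le_self_sq j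
  have sq' : ∀ j : ℤ, -(j : ℝ) ≤ (j : ℝ) ^ 2 := fun j => by
    have := sq (-j); push_cast at this; linarith [neg_sq (j : ℝ)]
  have am := sq m
  have an := sq n
  have as := sq (m + n)
  have bm := sq' m
  have bn := sq' n
  have bs := sq' (m + n)
  push_cast at as bs
  rcases le_total (0 : ℝ) m with hm | hm <;> rcases le_total (0 : ℝ) n with hn | hn <;>
    rcases le_total (0 : ℝ) (m + n) with hs | hs <;>
    nlinarith [mul_nonneg_of_nonpos_of_nonpos (sub_nonpos.2 hl2) (sub_nonpos.2 hk2)]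

lemma pt2_mem_vorCell_iff {a : ℝ} (ha : 0 < a) (x y : ℝ) :
    pt2 x y ∈ vorCell (ΔhexE a) ↔ InHexagon a x y := by
  have h3 : √3 ^ 2 = (3 : ℝ) := Real.sq_sqrt (by norm_num)
  have key : pt2 x y ∈ vorCell (ΔhexE a) ↔ ∀ m n : ℤ,
      m * x + n * ((x + √3 * y) / 2) ≤ a * ((m : ℝ) ^ 2 + m * n + n ^ 2) := by
    have step : ∀ m n : ℤ, ‖pt2 x y‖ ≤ ‖pt2 x y - pt2 (2 * a * m + a * n) (a * √3 * n)‖ ↔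
        m * x + n * ((x + √3 * y) / 2) ≤ a * ((m : ℝ) ^ 2 + m * n + n ^ 2) := fun m n => by
      have e : (x - (2 * a * m + a * n)) ^ 2 + (y - a * √3 * n) ^ 2 = x ^ 2 + y ^ 2 +
          4 * a * (a * ((m : ℝ) ^ 2 + m * n + n ^ 2) - (m * x + n * ((x + √3 * y) / 2))) := by
        linear_combination a ^ 2 * (n : ℝ) ^ 2 * h3
      rw [pt2_sub, norm_pt2, norm_pt2, Real.sqrt_le_sqrt_iff (by positivity), e]
      constructor
      · intro h
        by_contra! hlt
        nlinarith [mul_pos ha (sub_pos.2 hlt)]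
      · intro h
        nlinarith [mul_nonneg ha.le (sub_nonneg.2 h)]
    constructor
    · exact fun h m n => (step m n).1 (h _ ⟨m, n, rfl⟩)
    · rintro h q ⟨m, n, rfl⟩
      exact (step m n).2 (h m n)
  rw [key]
  constructor
  · intro h
    have h1 := h 1 0
    have h2 := h (-1) 0
    have h3 := h 0 1
    have h4 := h 0 (-1)
    have h5 := h 1 (-1)
    have h6 := h (-1) 1
    norm_num at h1 h2 h3 h4 h5 h6
    refine ⟨abs_le.2 ⟨?_, ?_⟩, abs_le.2 ⟨?_, ?_⟩, abs_le.2 ⟨?_, ?_⟩⟩ <;> linarith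
  · rintro ⟨h1, h2, h3⟩ m n
    rw [abs_le] at h1 h2 h3
    have := int_linear_le_hexagonal_form (l := x / a) (k := (x + √3 * y) / 2 / a)
      (abs_le.2 ⟨by rw [le_div_iff₀ ha]; linarith, by rw [div_le_iff₀ ha]; linarith⟩)
      (abs_le.2 ⟨by rw [le_div_iff₀ ha]; linarith, by rw [div_le_iff₀ ha]; linarith⟩)
      (by
        rw [← sub_div]
        exact abs_le.2 ⟨by rw [le_div_iff₀ ha]; linarith, by rw [div_le_iff₀ ha]; linarith⟩) m n
    calc m * x + n * ((x + √3 * y) / 2)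
        = a * (m * (x / a) + n * ((x + √3 * y) / 2 / a)) := by field_simp
      _ ≤ _ := by gcongr

/-- The covering radius of the unit hexagonal lattice, in lattice coordinates. -/
lemma exists_int_hexagonal_form_le (u v : ℝ) :
    ∃ m n : ℤ, (u - m) ^ 2 + (u - m) * (v - n) + (v - n) ^ 2 ≤ 1 / 3 := by
  have tri : ∀ r s : ℝ, 0 ≤ r → 0 ≤ s → r + s ≤ 1 → r ^ 2 + r * s + s ^ 2 ≤ 1 / 3 ∨
      (r - 1) ^ 2 + (r - 1) * s + s ^ 2 ≤ 1 / 3 ∨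
      r ^ 2 + r * (s - 1) + (s - 1) ^ 2 ≤ 1 / 3 := fun r s hr hs hrs => by
    by_contra! h
    obtain ⟨h1, h2, h3⟩ := h
    nlinarith [mul_nonneg (sub_nonneg.2 hrs) (sub_nonneg.2 h1.le), mul_nonneg hr (sub_nonneg.2 h2.le),
      mul_nonneg hs (sub_nonneg.2 h3.le), sq_nonneg (r - s), sq_nonneg (r + s - 2 / 3)]
  rcases le_total (Int.fract u + Int.fract v) 1 with h | h
  · rcases tri _ _ (Int.fract_nonneg u) (Int.fract_nonneg v) h with h | h | h <;>
      simp only [Int.fract] at h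
    · exact ⟨⌊u⌋, ⌊v⌋, h⟩
    · exact ⟨⌊u⌋ + 1, ⌊v⌋, by push_cast; linarith⟩
    · exact ⟨⌊u⌋, ⌊v⌋ + 1, by push_cast; linarith⟩
  · rcases tri (1 - Int.fract u) (1 - Int.fract v) (by linarith [Int.fract_lt_one u])
      (by linarith [Int.fract_lt_one v]) (by linarith) with h | h | h <;>
      simp only [Int.fract] at h
    · exact ⟨⌊u⌋ + 1, ⌊v⌋ + 1, by push_cast; linarith⟩
    · exact ⟨⌊u⌋, ⌊v⌋ + 1, by push_cast; linarith⟩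
    · exact ⟨⌊u⌋ + 1, ⌊v⌋, by push_cast; linarith⟩

lemma exists_hexLattice_dist_sq_le {a : ℝ} (ha : 0 < a) (x y : ℝ) :
    ∃ m n : ℤ, (x - (2 * a * m + a * n)) ^ 2 + (y - a * √3 * n) ^ 2 ≤ 4 * a ^ 2 / 3 := by
  have h3 : √3 ^ 2 = (3 : ℝ) := Real.sq_sqrt (by norm_num)
  have h30 : √3 ≠ (0 : ℝ) := by positivity
  obtain ⟨m, n, h⟩ := exists_int_hexagonal_form_le ((x - y / √3) / (2 * a)) (y / (a * √3))
  refine ⟨m, n, ?_⟩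
  obtain ⟨v, rfl⟩ : ∃ v, y = a * √3 * v := ⟨y / (a * √3), by field_simp⟩
  obtain ⟨u, rfl⟩ : ∃ u, x = 2 * a * u + a * v := ⟨(x - a * v) / (2 * a), by field_simp; ring⟩
  have e1 : (2 * a * u + a * v - a * √3 * v / √3) / (2 * a) = u := by field_simp; ring
  have e2 : a * √3 * v / (a * √3) = v := by field_simp
  rw [e1, e2] at h
  calc _ = 4 * a ^ 2 * ((u - m) ^ 2 + (u - m) * (v - n) + (v - n) ^ 2) := by
        linear_combination a ^ 2 * (v - n) ^ 2 * h3
    _ ≤ 4 * a ^ 2 * (1 / 3) := by gcongr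
    _ = _ := by ring

lemma eventually_abs_add_mul_le {A B k : ℝ} (hA : |A| ≤ B) (h : |A| < B ∨ k = 0) :
    ∀ᶠ ε in nhdsWithin (0 : ℝ) (Ioi 0), |A + ε * k| ≤ B := by
  rcases h with h | rfl
  · have : ContinuousAt (fun ε : ℝ => |A + ε * k|) 0 := by fun_prop
    have := this.eventually (gt_mem_nhds (by simpa using h : |A + 0 * k| < B))
    exact (this.filter_mono nhdsWithin_le_nhds).mono fun _ => le_of_lt
  · simpa using hA

/-- A vector satisfying the obtuse angle inequality at a point `(w₁, w₂)` of the hexagon has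
non-positive product with every direction along which one can leave `(w₁, w₂)` and stay in the
hexagon. -/
lemma normal_mul_direction_nonpos {a w₁ w₂ e₁ e₂ : ℝ} (hw : InHexagon a w₁ w₂)
    (hvi : ∀ u v, InHexagon a u v → e₁ * (u - w₁) + e₂ * (v - w₂) ≤ 0) (d₁ d₂ : ℝ)
    (h₁ : |w₁| < a ∨ d₁ = 0) (h₂ : |w₁ + √3 * w₂| < 2 * a ∨ d₁ + √3 * d₂ = 0)
    (h₃ : |w₁ - √3 * w₂| < 2 * a ∨ d₁ - √3 * d₂ = 0) : e₁ * d₁ + e₂ * d₂ ≤ 0 := by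
  obtain ⟨ε, ⟨⟨g1, g2⟩, g3⟩, hε⟩ := (((eventually_abs_add_mul_le hw.1 h₁).and
    (eventually_abs_add_mul_le hw.2.1 h₂)).and (eventually_abs_add_mul_le hw.2.2 h₃)).and
    self_mem_nhdsWithin |>.exists
  have hε : 0 < ε := hε
  have := hvi (w₁ + ε * d₁) (w₂ + ε * d₂) ⟨g1, by convert g2 using 2; ring,
    by convert g3 using 2; ring⟩
  by_contra! hlt
  nlinarith [mul_pos hε hlt]

/-- Translating by `k` times `v` from a point of a bisector of `0` and `± v` does not increase the
distance to `ℤ v`. -/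
lemma exists_int_dist_sq_le_of_bisector {w₁ w₂ v₁ v₂ : ℝ}
    (h : |2 * (w₁ * v₁ + w₂ * v₂)| = v₁ ^ 2 + v₂ ^ 2) (k : ℝ) :
    ∃ m : ℤ, (w₁ + k * v₁ - m * v₁) ^ 2 + (w₂ + k * v₂ - m * v₂) ^ 2 ≤ w₁ ^ 2 + w₂ ^ 2 := by
  have hv : 0 ≤ v₁ ^ 2 + v₂ ^ 2 := by positivity
  rcases (abs_eq hv).1 h with h | h
  · refine ⟨⌈k⌉, ?_⟩
    have := mul_nonneg hv (mul_nonneg (sub_nonneg.2 (Int.le_ceil k))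
      (sub_nonneg.2 (Int.ceil_lt_add_one k).le))
    linear_combination this + (k - ⌈k⌉) * h
  · refine ⟨⌊k⌋, ?_⟩
    have := mul_nonneg hv (mul_nonneg (sub_nonneg.2 (Int.floor_le k))
      (sub_nonneg.2 (Int.lt_floor_add_one k).le))
    linear_combination this + (k - ⌊k⌋) * h

/-- If `(w₁, w₂)` is the nearest point of the hexagon to `(x, y)`, then some lattice point is
at distance at most `‖(w₁, w₂)‖` from `(x, y)`. -/
lemma exists_hexLattice_dist_sq_le_of_projection {a : ℝ} (ha : 0 < a) {x y w₁ w₂ : ℝ}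
    (hw : InHexagon a w₁ w₂)
    (hvi : ∀ u v, InHexagon a u v → (x - w₁) * (u - w₁) + (y - w₂) * (v - w₂) ≤ 0) :
    ∃ m n : ℤ, (x - (2 * a * m + a * n)) ^ 2 + (y - a * √3 * n) ^ 2 ≤ w₁ ^ 2 + w₂ ^ 2 := by
  have h3 : √3 ^ 2 = (3 : ℝ) := Real.sq_sqrt (by norm_num)
  have h30 : 0 < √3 := by positivity
  rcases le_or_gt (4 * a ^ 2 / 3) (w₁ ^ 2 + w₂ ^ 2) with hbig | hsmall
  · obtain ⟨m, n, h⟩ := exists_hexLattice_dist_sq_le ha x y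
    exact ⟨m, n, h.trans hbig⟩
  have dir := normal_mul_direction_nonpos hw hvi
  by_cases hall : |w₁| < a ∧ |w₁ + √3 * w₂| < 2 * a ∧ |w₁ - √3 * w₂| < 2 * a
  · have := dir (x - w₁) (y - w₂) (.inl hall.1) (.inl hall.2.1) (.inl hall.2.2)
    have hx : x = w₁ := by nlinarith [sq_nonneg (x - w₁), sq_nonneg (y - w₂)]
    have hy : y = w₂ := by nlinarith [sq_nonneg (x - w₁), sq_nonneg (y - w₂)]
    exact ⟨0, 0, by simp [hx, hy]⟩
  have sqabs : ∀ {A B : ℝ}, |A| = B → A ^ 2 = B ^ 2 := fun h => by rw [← h, sq_abs]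
  have alt1 : |w₁| < a ∨ |w₁| = a := lt_or_eq_of_le hw.1
  have alt2 : |w₁ + √3 * w₂| < 2 * a ∨ |w₁ + √3 * w₂| = 2 * a := lt_or_eq_of_le hw.2.1
  have alt3 : |w₁ - √3 * w₂| < 2 * a ∨ |w₁ - √3 * w₂| = 2 * a := lt_or_eq_of_le hw.2.2
  have hq : (√3 * w₂) ^ 2 = 3 * w₂ ^ 2 := by rw [mul_pow, h3]
  have no12 : |w₁| = a → |w₁ + √3 * w₂| = 2 * a → False := fun g1 g2 => by
    nlinarith [sqabs g1, sqabs g2, sq_nonneg (w₁ - √3 * w₂)]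
  have no13 : |w₁| = a → |w₁ - √3 * w₂| = 2 * a → False := fun g1 g2 => by
    nlinarith [sqabs g1, sqabs g2, sq_nonneg (w₁ + √3 * w₂)]
  have no23 : |w₁ + √3 * w₂| = 2 * a → |w₁ - √3 * w₂| = 2 * a → False := fun g1 g2 => by
    nlinarith [sqabs g1, sqabs g2, sq_nonneg w₁]
  rcases alt1 with g1 | g1
  · rcases alt2 with g2 | g2
    · have g3 : |w₁ - √3 * w₂| = 2 * a := alt3.resolve_left fun g3 => hall ⟨g1, g2, g3⟩
      have p1 := dir √3 1 (.inl g1) (.inl g2) (.inr (by ring))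
      have p2 := dir (-√3) (-1) (.inl g1) (.inl g2) (.inr (by ring))
      obtain ⟨m, hm⟩ := exists_int_dist_sq_le_of_bisector (w₁ := w₁) (w₂ := w₂) (v₁ := a)
        (v₂ := -(a * √3)) (by
          rw [show 2 * (w₁ * a + w₂ * -(a * √3)) = 2 * a * (w₁ - √3 * w₂) by ring, abs_mul, g3,
            abs_of_pos (by positivity)]
          linear_combination -a ^ 2 * h3) ((x - w₁) / a)
      refine ⟨m, -m, le_of_eq_of_le ?_ hm⟩
      have hy : y = w₂ - √3 * (x - w₁) := by linarith
      rw [hy]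
      push_cast
      field_simp
      ring
    · have g3 : |w₁ - √3 * w₂| < 2 * a := alt3.resolve_right (no23 g2)
      have p1 := dir √3 (-1) (.inl g1) (.inr (by ring)) (.inl g3)
      have p2 := dir (-√3) 1 (.inl g1) (.inr (by ring)) (.inl g3)
      obtain ⟨m, hm⟩ := exists_int_dist_sq_le_of_bisector (w₁ := w₁) (w₂ := w₂) (v₁ := a)
        (v₂ := a * √3) (by
          rw [show 2 * (w₁ * a + w₂ * (a * √3)) = 2 * a * (w₁ + √3 * w₂) by ring, abs_mul, g2,
            abs_of_pos (by positivity)]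
          linear_combination -a ^ 2 * h3) ((x - w₁) / a)
      refine ⟨0, m, le_of_eq_of_le ?_ hm⟩
      have hy : y = w₂ + √3 * (x - w₁) := by linarith
      rw [hy]
      push_cast
      field_simp
      ring
  · have g2 := alt2.resolve_right (no12 g1)
    have g3 := alt3.resolve_right (no13 g1)
    have p1 := dir 0 1 (.inr rfl) (.inl g2) (.inl g3)
    have p2 := dir 0 (-1) (.inr rfl) (.inl g2) (.inl g3)
    have hy : y = w₂ := by linarith
    obtain ⟨m, hm⟩ := exists_int_dist_sq_le_of_bisector (w₁ := w₁) (w₂ := w₂) (v₁ := 2 * a)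
      (v₂ := 0) (by
        rw [show 2 * (w₁ * (2 * a) + w₂ * 0) = 4 * a * w₁ by ring, abs_mul, g1,
          abs_of_pos (by positivity)]
        ring) ((x - w₁) / (2 * a))
    refine ⟨m, 0, le_of_eq_of_le ?_ hm⟩
    rw [hy]
    push_cast
    field_simp
    ring

lemma infDist_hexLattice_le {a x y r : ℝ}
    (h : ∃ m n : ℤ, (x - (2 * a * m + a * n)) ^ 2 + (y - a * √3 * n) ^ 2 ≤ r) :
    Metric.infDist (pt2 x y) (ΔhexE a) ≤ √r := by
  obtain ⟨m, n, h⟩ := h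
  have hmem : pt2 (2 * a * m + a * n) (a * √3 * n) ∈ ΔhexE a := ⟨m, n, rfl⟩
  refine (Metric.infDist_le_dist_of_mem hmem).trans ?_
  rw [dist_eq_norm, pt2_sub, norm_pt2]
  exact Real.sqrt_le_sqrt h

lemma norm_le_infDist_of_mem_vorCell {Δ : Set (EuclideanSpace ℝ (Fin 2))} (hΔ : Δ.Nonempty)
    {p : EuclideanSpace ℝ (Fin 2)} (hp : p ∈ vorCell Δ) : ‖p‖ ≤ Metric.infDist p Δ :=
  (Metric.le_infDist hΔ).2 fun q hq => (hp q hq).trans_eq (dist_eq_norm p q).symm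

lemma cos_infDist_sq_projection_le {a : ℝ} (ha : 0 < a) (ha' : a < π * √3 / 4) {x y w₁ w₂ : ℝ}
    (hw : InHexagon a w₁ w₂)
    (hvi : ∀ u v, InHexagon a u v → (x - w₁) * (u - w₁) + (y - w₂) * (v - w₂) ≤ 0) :
    cos (Metric.infDist (pt2 w₁ w₂) (ΔhexE a)) ^ 2 ≤
      cos (Metric.infDist (pt2 x y) (ΔhexE a)) ^ 2 := by
  have h3 : √3 ^ 2 = (3 : ℝ) := Real.sq_sqrt (by norm_num)
  have hne : (ΔhexE a).Nonempty := ⟨_, 0, 0, rfl⟩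
  have hle : Metric.infDist (pt2 x y) (ΔhexE a) ≤ Metric.infDist (pt2 w₁ w₂) (ΔhexE a) :=
    (infDist_hexLattice_le (exists_hexLattice_dist_sq_le_of_projection ha hw hvi)).trans <|
      (norm_pt2 w₁ w₂).symm.trans_le <|
        norm_le_infDist_of_mem_vorCell hne ((pt2_mem_vorCell_iff ha w₁ w₂).2 hw)
  have hpi : Metric.infDist (pt2 w₁ w₂) (ΔhexE a) ≤ π / 2 := by
    refine (infDist_hexLattice_le (exists_hexLattice_dist_sq_le ha w₁ w₂)).trans ?_
    refine Real.sqrt_le_iff.2 ⟨by positivity, ?_⟩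
    have : a ^ 2 ≤ (π * √3 / 4) ^ 2 := by gcongr
    rw [div_pow, mul_pow, h3] at this
    linarith
  have h0 : 0 ≤ Metric.infDist (pt2 w₁ w₂) (ΔhexE a) := Metric.infDist_nonneg
  have := cos_nonneg_of_neg_pi_div_two_le_of_le (by linarith) hpi
  gcongr
  exact cos_le_cos_of_nonneg_of_le_pi Metric.infDist_nonneg (by linarith) hle

lemma convex_hexagonal_prism (a c : ℝ) :
    Convex ℝ {w : EuclideanSpace ℝ (Fin 3) | InHexagon a (w 0) (w 1) ∧ w 2 ∈ Icc 0 c} := by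
  have abs_comb : ∀ {r A B s t : ℝ}, |A| ≤ r → |B| ≤ r → 0 ≤ s → 0 ≤ t → s + t = 1 →
      |s * A + t * B| ≤ r := fun hA hB hs ht hst =>
    abs_le.2 (convex_Icc _ _ (abs_le.1 hA) (abs_le.1 hB) hs ht hst)
  rintro p ⟨⟨p1, p2, p3⟩, p4⟩ q ⟨⟨q1, q2, q3⟩, q4⟩ s t hs ht hst
  refine ⟨⟨?_, ?_, ?_⟩, ?_⟩
  · exact abs_comb p1 q1 hs ht hst
  · convert abs_comb p2 q2 hs ht hst using 2
    simp; ring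
  · convert abs_comb p3 q3 hs ht hst using 2
    simp; ring
  · exact convex_Icc _ _ p4 q4 hs ht hst

lemma inner_le_zero_of_nearest {E : Type*} [NormedAddCommGroup E] [InnerProductSpace ℝ E]
    {D : Set E} (hD : Convex ℝ D) {x p : E} (hp : p ∈ D) (hmin : ∀ y ∈ D, dist x p ≤ dist x y) :
    ∀ y ∈ D, inner ℝ (x - p) (y - p) ≤ 0 := by
  refine (norm_eq_iInf_iff_real_inner_le_zero hD hp).1 (le_antisymm ?_ ?_)
  · have : Nonempty D := ⟨⟨p, hp⟩⟩
    exact le_ciInf fun w => by simpa [dist_eq_norm] using hmin w w.2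
  · exact ciInf_le (f := fun w : D => ‖x - w‖) ⟨0, by rintro _ ⟨w, rfl⟩; positivity⟩ ⟨p, hp⟩

lemma deriv_sq_add_deriv_sq_le_of_differentiableAt {f g F G : ℝ → ℝ} {t : ℝ}
    (hf : DifferentiableAt ℝ f t) (hg : DifferentiableAt ℝ g t)
    (hF : DifferentiableAt ℝ F t) (hG : DifferentiableAt ℝ G t)
    (h : ∀ s, (F s - F t) ^ 2 + (G s - G t) ^ 2 ≤ (f s - f t) ^ 2 + (g s - g t) ^ 2) :
    deriv F t ^ 2 + deriv G t ^ 2 ≤ deriv f t ^ 2 + deriv g t ^ 2 := by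
  have lim : ∀ {k : ℝ → ℝ}, DifferentiableAt ℝ k t →
      Filter.Tendsto (slope k t) (nhdsWithin t {t}ᶜ) (nhds (deriv k t)) :=
    fun hk => hasDerivAt_iff_tendsto_slope.1 hk.hasDerivAt
  refine le_of_tendsto_of_tendsto' (((lim hF).pow 2).add ((lim hG).pow 2))
    (((lim hf).pow 2).add ((lim hg).pow 2)) fun s => ?_
  simp only [slope_def_field, div_pow, ← add_div]
  exact div_le_div_of_nonneg_right (h s) (sq_nonneg _)

/-- Planar speeds compare as increments do, also where `F` or `G` is not differentiable. -/
lemma deriv_sq_add_deriv_sq_le {f g F G : ℝ → ℝ} {t : ℝ}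
    (hf : DifferentiableAt ℝ f t) (hg : DifferentiableAt ℝ g t)
    (h : ∀ s, (F s - F t) ^ 2 + (G s - G t) ^ 2 ≤ (f s - f t) ^ 2 + (g s - g t) ^ 2) :
    deriv F t ^ 2 + deriv G t ^ 2 ≤ deriv f t ^ 2 + deriv g t ^ 2 := by
  have h0 : DifferentiableAt ℝ (fun _ : ℝ => (0 : ℝ)) t := differentiableAt_const 0
  by_cases hF : DifferentiableAt ℝ F t <;> by_cases hG : DifferentiableAt ℝ G t
  · exact deriv_sq_add_deriv_sq_le_of_differentiableAt hf hg hF hG h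
  · have := deriv_sq_add_deriv_sq_le_of_differentiableAt hf hg hF h0 fun s => by
      linarith [h s, sq_nonneg (G s - G t)]
    simpa [deriv_zero_of_not_differentiableAt hG] using this
  · have := deriv_sq_add_deriv_sq_le_of_differentiableAt hf hg h0 hG fun s => by
      linarith [h s, sq_nonneg (F s - F t)]
    simpa [deriv_zero_of_not_differentiableAt hF] using this
  · rw [deriv_zero_of_not_differentiableAt hF, deriv_zero_of_not_differentiableAt hG]
    simp only [ne_eq, OfNat.ofNat_ne_zero, not_false_eq_true, zero_pow, add_zero]
    positivity

lemma exists_abs_deriv_le_of_contDiffOn_Icc {f : ℝ → ℝ} {u v : ℝ} (huv : u < v)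
    (hf : ContDiffOn ℝ 1 f (Icc u v)) :
    ∃ C, ∀ t ∈ Ioo u v, DifferentiableAt ℝ f t ∧ |deriv f t| ≤ C := by
  have hcont : ContinuousOn (derivWithin f (Icc u v)) (Icc u v) :=
    hf.continuousOn_derivWithin (uniqueDiffOn_Icc huv) le_rfl
  obtain ⟨C, hC⟩ := isCompact_Icc.exists_bound_of_continuousOn hcont
  refine ⟨C, fun t ht => ?_⟩
  have hn : Icc u v ∈ nhds t := Icc_mem_nhds ht.1 ht.2
  exact ⟨(hf.differentiableOn one_ne_zero).differentiableAt hn,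
    (derivWithin_of_mem_nhds (f := f) hn) ▸ hC t (Ioo_subset_Icc_self ht)⟩

lemma PC1.exists_ae_abs_deriv_le {f : ℝ → ℝ} (hf : PC1 f) :
    ∃ C, ∀ᵐ t ∂volume.restrict (Ioc (0 : ℝ) 1), DifferentiableAt ℝ f t ∧ |deriv f t| ≤ C := by
  obtain ⟨n, τ, h0, h1, hlt, -, hC⟩ := hf
  have ind : ∀ k ≤ n, ∃ C, ∀ᵐ t ∂volume.restrict (Ioc (0 : ℝ) (τ k)),
      DifferentiableAt ℝ f t ∧ |deriv f t| ≤ C := fun k => by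
    induction k with
    | zero => exact fun _ => ⟨0, by simp [h0]⟩
    | succ k ih =>
      intro hk
      obtain ⟨A, hA⟩ := ih (by lia)
      obtain ⟨B, hB⟩ := exists_abs_deriv_le_of_contDiffOn_Icc (hlt k hk) (hC k hk)
      refine ⟨max A B, ?_⟩
      rw [ae_restrict_iff' measurableSet_Ioc] at hA ⊢
      filter_upwards [hA, Measure.ae_ne volume (τ (k + 1))] with t ht hne hmem
      rcases le_or_gt t (τ k) with hle | hgt
      · exact (ht ⟨hmem.1, hle⟩).imp_right fun h => h.trans (le_max_left _ _)
      · exact (hB t ⟨hgt, hmem.2.lt_of_ne hne⟩).imp_right fun h => h.trans (le_max_right _ _)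
  simpa [h1] using ind n le_rfl

lemma PC1.aestronglyMeasurable {f : ℝ → ℝ} (hf : PC1 f) :
    AEStronglyMeasurable f (volume.restrict (Ioc (0 : ℝ) 1)) := by
  obtain ⟨n, τ, -, -, -, hc, -⟩ := hf
  exact (hc.mono Ioc_subset_Icc_self).aestronglyMeasurable measurableSet_Ioc

lemma integrable_singular_speed (Δ : Set (EuclideanSpace ℝ (Fin 2))) {f g h : ℝ → ℝ}
    (hf : PC1 f) (hg : PC1 g) (hh : PC1 h) :
    Integrable (fun t => √(deriv f t ^ 2 + deriv g t ^ 2 +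
      cos (Metric.infDist (pt2 (f t) (g t)) Δ) ^ 2 * deriv h t ^ 2))
      (volume.restrict (Ioc (0 : ℝ) 1)) := by
  obtain ⟨A, hA⟩ := hf.exists_ae_abs_deriv_le
  obtain ⟨B, hB⟩ := hg.exists_ae_abs_deriv_le
  obtain ⟨C, hC⟩ := hh.exists_ae_abs_deriv_le
  refine Integrable.of_bound (C := √(A ^ 2 + B ^ 2 + 1 * C ^ 2)) ?_ ?_
  · have m : ∀ k : ℝ → ℝ, AEStronglyMeasurable (fun t => deriv k t ^ 2)
        (volume.restrict (Ioc (0 : ℝ) 1)) := fun k =>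
      ((measurable_deriv k).pow_const 2).aestronglyMeasurable
    have mc : AEStronglyMeasurable (fun t => cos (Metric.infDist (pt2 (f t) (g t)) Δ) ^ 2)
        (volume.restrict (Ioc (0 : ℝ) 1)) := by
      have cont : Continuous fun p : ℝ × ℝ => cos (Metric.infDist (pt2 p.1 p.2) Δ) ^ 2 :=
        (continuous_cos.comp ((Metric.continuous_infDist_pt Δ).comp continuous_pt2)).pow 2
      have pair : AEStronglyMeasurable (fun t => (f t, g t)) (volume.restrict (Ioc (0 : ℝ) 1)) :=
        hf.aestronglyMeasurable.prodMk hg.aestronglyMeasurable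
      have := cont.comp_aestronglyMeasurable pair
      exact this
    exact continuous_sqrt.comp_aestronglyMeasurable (((m f).add (m g)).add (mc.mul (m h)))
  · filter_upwards [hA, hB, hC] with t ⟨_, hA⟩ ⟨_, hB⟩ ⟨_, hC⟩
    rw [Real.norm_of_nonneg (Real.sqrt_nonneg _)]
    refine Real.sqrt_le_sqrt ?_
    gcongr ?_ + ?_ + ?_ * ?_
    · exact sq_le_sq' (abs_le.1 hA).1 (abs_le.1 hA).2
    · exact sq_le_sq' (abs_le.1 hB).1 (abs_le.1 hB).2
    · exact cos_sq_le_one _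
    · exact sq_le_sq' (abs_le.1 hC).1 (abs_le.1 hC).2

/-- for `0 < a < π√3/4`, `Δ = Δ_hex(a)`, `c > 0`, the nearest-point projection
`P` of `ℝ³` onto the closed convex hexagonal prism `D = H(Δ) × [0,c]` does not increase the
singular length: `L_Δ(P ∘ γ) ≤ L_Δ(γ)` for every piecewise `C¹` curve `γ : [0,1] → ℝ³`. -/
theorem projection_shortens_singular_length (a : ℝ) (ha : 0 < a)
    (ha' : a < π * Real.sqrt 3 / 4) (c : ℝ) (hc : 0 < c)
    (D : Set (EuclideanSpace ℝ (Fin 3)))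
    (hD : D = {w | pt2 (w 0) (w 1) ∈ vorCell (ΔhexE a) ∧ w 2 ∈ Set.Icc 0 c})
    (P : EuclideanSpace ℝ (Fin 3) → EuclideanSpace ℝ (Fin 3))
    (hP : ∀ x, P x ∈ D ∧ ∀ y ∈ D, dist x (P x) ≤ dist x y)
    (γ : ℝ → EuclideanSpace ℝ (Fin 3))
    (h₁ : PC1 (fun t => γ t 0)) (h₂ : PC1 (fun t => γ t 1)) (h₃ : PC1 (fun t => γ t 2)) :
    sLen3 (ΔhexE a) (fun t => P (γ t)) ≤ sLen3 (ΔhexE a) γ := by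
  have hD' : D = {w | InHexagon a (w 0) (w 1) ∧ w 2 ∈ Icc 0 c} := by
    simp only [hD, pt2_mem_vorCell_iff ha]
  have hmem : ∀ x, InHexagon a (P x 0) (P x 1) ∧ P x 2 ∈ Icc 0 c := fun x => by
    have := (hP x).1
    rwa [hD'] at this
  have hvi : ∀ x u v s, InHexagon a u v → s ∈ Icc 0 c →
      (x 0 - P x 0) * (u - P x 0) + (x 1 - P x 1) * (v - P x 1) +
        (x 2 - P x 2) * (s - P x 2) ≤ 0 := fun x u v s huv hs => by
    have := inner_le_zero_of_nearest (hD' ▸ convex_hexagonal_prism a c) (hP x).1 (hP x).2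
      !₂[u, v, s] (hD' ▸ ⟨huv, hs⟩)
    rw [real_inner_comm] at this
    simpa [PiLp.inner_apply, Fin.sum_univ_three] using this
  have hplane : ∀ x u v, InHexagon a u v →
      (x 0 - P x 0) * (u - P x 0) + (x 1 - P x 1) * (v - P x 1) ≤ 0 := fun x u v huv => by
    simpa using hvi x u v (P x 2) huv (hmem x).2
  have hheight : ∀ x, ∀ s ∈ Icc 0 c, (x 2 - P x 2) * (s - P x 2) ≤ 0 := fun x s hs => by
    simpa using hvi x _ _ s (hmem x).1 hs
  have hplane_lip : ∀ x y, (P x 0 - P y 0) ^ 2 + (P x 1 - P y 1) ^ 2 ≤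
      (x 0 - y 0) ^ 2 + (x 1 - y 1) ^ 2 := fun x y => by
    nlinarith [hplane x _ _ (hmem y).1, hplane y _ _ (hmem x).1,
      sq_nonneg (x 0 - y 0 - (P x 0 - P y 0)), sq_nonneg (x 1 - y 1 - (P x 1 - P y 1))]
  have hheight_lip : ∀ x y, (P x 2 - P y 2) ^ 2 ≤ (x 2 - y 2) ^ 2 := fun x y => by
    nlinarith [hheight x _ (hmem y).2, hheight y _ (hmem x).2,
      sq_nonneg (x 2 - y 2 - (P x 2 - P y 2))]
  obtain ⟨_, hA⟩ := h₁.exists_ae_abs_deriv_le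
  obtain ⟨_, hB⟩ := h₂.exists_ae_abs_deriv_le
  obtain ⟨_, hC⟩ := h₃.exists_ae_abs_deriv_le
  unfold sLen3
  rw [intervalIntegral.integral_of_le zero_le_one, intervalIntegral.integral_of_le zero_le_one]
  refine integral_mono_of_nonneg (.of_forall fun t => Real.sqrt_nonneg _)
    (integrable_singular_speed (ΔhexE a) h₁ h₂ h₃) ?_
  filter_upwards [hA, hB, hC] with t ⟨hA, _⟩ ⟨hB, _⟩ ⟨hC, _⟩
  refine Real.sqrt_le_sqrt (add_le_add ?_ (mul_le_mul ?_ ?_ (sq_nonneg _) (sq_nonneg _)))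
  · exact deriv_sq_add_deriv_sq_le hA hB fun s => hplane_lip (γ s) (γ t)
  · exact cos_infDist_sq_projection_le ha ha' (hmem (γ t)).1 (hplane (γ t))
  · have := deriv_sq_add_deriv_sq_le (F := fun s => P (γ s) 2) (G := fun _ => 0) hC
      (differentiableAt_const 0) fun s => by simpa using hheight_lip (γ s) (γ t)
    simpa using this

end
end

section
/- Let 0 < a < π/(2√2), let Δ = Δ_sq(a) be the square lattice 2aℤ × 2aℤ, let Λ = 4aℤ × 4aℤ × 2πℤ ⊂ ℝ³, and let σ₀(x,y,z) = (−x, −y, z + π). Then for every v ∈ Λ, every m ∈ ℝ³ and every piecewise C¹ curve γ : [0,1] → ℝ³ with γ(0) = m and γ(1) = σ₀(m) + v, one has L_Δ(γ) ≥ π. (In the singular torus (T, g_c) = (ℝ³,h)/Λ this says dist(m, σ(m)) ≥ π for every point m.) -/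
open Real MeasureTheory Set

noncomputable section

/-- Length of `γ = (γ₁,γ₂,γ₃)` for the singular metric
`h = dx² + dy² + cos²(dist((x,y),Δ)) dz²`. -/
def sLen (Δ : Set (EuclideanSpace ℝ (Fin 2))) (γ₁ γ₂ γ₃ : ℝ → ℝ) : ℝ :=
  ∫ t in (0:ℝ)..1, Real.sqrt ((deriv γ₁ t) ^ 2 + (deriv γ₂ t) ^ 2 +
    Real.cos (Metric.infDist (pt2 (γ₁ t) (γ₂ t)) Δ) ^ 2 * (deriv γ₃ t) ^ 2)

/-- The square lattice `Δ_sq(a) = 2aℤ × 2aℤ ⊂ ℝ²`. -/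
def ΔsqE (a : ℝ) : Set (EuclideanSpace ℝ (Fin 2)) :=
  {p | ∃ m n : ℤ, p = pt2 (2 * a * m) (2 * a * n)}

/-- The spatial lattice `Λ = 4aℤ × 4aℤ × 2πℤ ⊂ ℝ³`. -/
def Λsq3 (a : ℝ) : Set (ℝ × ℝ × ℝ) :=
  {w | ∃ k₁ k₂ k₃ : ℤ, w = (4 * a * k₁, 4 * a * k₂, 2 * π * k₃)}

/-- The screw motion `σ₀(x,y,z) = (−x, −y, z + π)`. -/
def sigma0 (p : ℝ × ℝ × ℝ) : ℝ × ℝ × ℝ := (-p.1, -p.2.1, p.2.2 + π)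

open Filter Topology

theorem abs_arcsin_sin_sub_le (x y : ℝ) : |arcsin (sin x) - arcsin (sin y)| ≤ |x - y| := by
  have key : ∀ x : ℝ, ∃ k : ℤ, x = arcsin (sin x) + 2 * k * π ∨
      x = π - arcsin (sin x) + 2 * k * π := by
    intro x
    have h : sin (arcsin (sin x)) = sin x := sin_arcsin (neg_one_le_sin x) (sin_le_one x)
    obtain ⟨k, hk | hk⟩ := sin_eq_sin_iff.1 h
    · exact ⟨k, Or.inl (by linarith)⟩
    · exact ⟨k, Or.inr (by linarith)⟩
  have hx₁ := neg_pi_div_two_le_arcsin (sin x)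
  have hx₂ := arcsin_le_pi_div_two (sin x)
  have hy₁ := neg_pi_div_two_le_arcsin (sin y)
  have hy₂ := arcsin_le_pi_div_two (sin y)
  have cover : ∀ k : ℤ, k = 0 ∨ π ≤ k * π ∨ k * π ≤ -π := by
    intro k
    rcases lt_trichotomy k 0 with h | h | h
    · right; right
      have : (k : ℝ) ≤ -1 := by exact_mod_cast Int.le_sub_one_of_lt h
      nlinarith [pi_pos]
    · exact Or.inl h
    · right; left
      have : (1 : ℝ) ≤ k := by exact_mod_cast h
      nlinarith [pi_pos]
  obtain ⟨k, hk⟩ := key x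
  obtain ⟨l, hl⟩ := key y
  set α := arcsin (sin x)
  set β := arcsin (sin y)
  rcases hk with hk | hk <;> rcases hl with hl | hl
  · have e : x - y = α - β + 2 * ((k - l : ℤ) * π) := by push_cast; linarith
    rw [e]
    rcases cover (k - l) with h | h | h
    · simp [h]
    · exact abs_le_abs (by linarith) (by linarith)
    · rw [← abs_neg (_ + _)]
      exact abs_le_abs (by linarith) (by linarith)
  · have e : x - y = α + β - π + 2 * ((k - l : ℤ) * π) := by push_cast; linarith
    rw [e]
    rcases cover (k - l) with h | h | h
    · rw [h, ← abs_neg (_ + _)]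
      push_cast
      exact abs_le_abs (by linarith) (by linarith)
    · exact abs_le_abs (by linarith) (by linarith)
    · rw [← abs_neg (_ + _)]
      exact abs_le_abs (by linarith) (by linarith)
  · have e : x - y = π - α - β + 2 * ((k - l : ℤ) * π) := by push_cast; linarith
    rw [e]
    rcases cover (k - l) with h | h | h
    · rw [h]
      push_cast
      exact abs_le_abs (by linarith) (by linarith)
    · exact abs_le_abs (by linarith) (by linarith)
    · rw [← abs_neg (_ + _)]
      exact abs_le_abs (by linarith) (by linarith)
  · have e : x - y = β - α + 2 * ((k - l : ℤ) * π) := by push_cast; linarith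
    rw [e]
    rcases cover (k - l) with h | h | h
    · simp [h, abs_sub_comm]
    · exact abs_le_abs (by linarith) (by linarith)
    · rw [← abs_neg (_ + _)]
      exact abs_le_abs (by linarith) (by linarith)

theorem exists_abs_sub_int_mul_pi_eq (x : ℝ) :
    ∃ k : ℤ, |x - k * π| = |arcsin (sin x)| := by
  have h : sin (arcsin (sin x)) = sin x := sin_arcsin (neg_one_le_sin x) (sin_le_one x)
  obtain ⟨k, hk | hk⟩ := sin_eq_sin_iff.1 h
  · have : x - (2 * k : ℤ) * π = arcsin (sin x) := by push_cast; linarith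
    exact ⟨2 * k, by rw [this]⟩
  · have : x - (2 * k + 1 : ℤ) * π = -arcsin (sin x) := by push_cast; linarith
    exact ⟨2 * k + 1, by rw [this, abs_neg]⟩

/-- The triangle wave folding `ℝ` onto `[-a, a]` by the reflections in the odd multiples of `a`. -/
def fold (a x : ℝ) : ℝ := 2 * a / π * arcsin (sin (π / (2 * a) * x))

theorem abs_fold_sub_le {a : ℝ} (ha : 0 < a) (x y : ℝ) : |fold a x - fold a y| ≤ |x - y| := by
  have hc : 0 < 2 * a / π := by positivity
  have h := abs_arcsin_sin_sub_le (π / (2 * a) * x) (π / (2 * a) * y)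
  rw [← mul_sub, abs_mul, abs_of_pos (by positivity : 0 < π / (2 * a))] at h
  rw [fold, fold, ← mul_sub, abs_mul, abs_of_pos hc]
  calc _ ≤ 2 * a / π * (π / (2 * a) * |x - y|) := by gcongr
    _ = |x - y| := by field_simp

theorem abs_fold_le {a : ℝ} (ha : 0 < a) (x : ℝ) : |fold a x| ≤ a := by
  have hc : 0 < 2 * a / π := by positivity
  rw [fold, abs_mul, abs_of_pos hc]
  calc _ ≤ 2 * a / π * (π / 2) := by
        gcongr
        exact abs_le.2 ⟨neg_pi_div_two_le_arcsin _, arcsin_le_pi_div_two _⟩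
    _ = a := by field_simp

theorem exists_abs_sub_two_mul_eq_fold {a : ℝ} (ha : 0 < a) (x : ℝ) :
    ∃ k : ℤ, |x - 2 * a * k| = |fold a x| := by
  have hc : 0 < 2 * a / π := by positivity
  obtain ⟨k, hk⟩ := exists_abs_sub_int_mul_pi_eq (π / (2 * a) * x)
  refine ⟨k, ?_⟩
  rw [fold, abs_mul, ← hk, ← abs_mul]
  congr 1
  field_simp

theorem fold_neg_add {a : ℝ} (ha : 0 < a) (x : ℝ) (k : ℤ) :
    fold a (-x + 4 * a * k) = -fold a x := by
  have : π / (2 * a) * (-x + 4 * a * k) = -(π / (2 * a) * x) + k * (2 * π) := by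
    field_simp; ring
  rw [fold, fold, this, sin_add_int_mul_two_pi, sin_neg, arcsin_neg, mul_neg]

theorem sinc_mul_self (r : ℝ) : sinc r * r = sin r := by
  rcases eq_or_ne r 0 with rfl | h
  · simp
  · rw [sinc_of_ne_zero h, div_mul_cancel₀ _ h]

theorem chord_sq_le {x₁ y₁ r₁ x₂ y₂ r₂ : ℝ} (z₁ z₂ : ℝ) (hr₁ : 0 ≤ r₁) (hr₂ : 0 ≤ r₂)
    (h₁ : r₁ ^ 2 = x₁ ^ 2 + y₁ ^ 2) (h₂ : r₂ ^ 2 = x₂ ^ 2 + y₂ ^ 2)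
    (hc : 0 ≤ cos r₁ * cos r₂) :
    (cos r₁ * cos z₁ - cos r₂ * cos z₂) ^ 2 + (cos r₁ * sin z₁ - cos r₂ * sin z₂) ^ 2
      + (sinc r₁ * x₁ - sinc r₂ * x₂) ^ 2 + (sinc r₁ * y₁ - sinc r₂ * y₂) ^ 2
      ≤ (x₁ - x₂) ^ 2 + (y₁ - y₂) ^ 2 + cos r₁ * cos r₂ * (z₁ - z₂) ^ 2 := by
  have hd : x₁ * x₂ + y₁ * y₂ ≤ r₁ * r₂ := by
    refine abs_le_of_sq_le_sq' ?_ (by positivity) |>.2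
    rw [mul_pow, h₁, h₂]
    nlinarith [sq_nonneg (x₁ * y₂ - x₂ * y₁)]
  have hs : sinc r₁ * sinc r₂ ≤ 1 := by
    have := mul_le_mul (abs_sinc_le_one r₁) (abs_sinc_le_one r₂) (abs_nonneg _) zero_le_one
    rw [← abs_mul] at this
    linarith [le_abs_self (sinc r₁ * sinc r₂)]
  have e₁ := sinc_mul_self r₁
  have e₂ := sinc_mul_self r₂
  have c₁ := one_sub_sq_div_two_le_cos (x := r₁ - r₂)
  have c₂ := one_sub_sq_div_two_le_cos (x := z₁ - z₂)
  have c₃ := mul_le_mul_of_nonneg_left c₂ hc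
  have hm := mul_le_mul_of_nonneg_left hd (sub_nonneg.2 hs)
  have p₁ := sin_sq_add_cos_sq r₁
  have p₂ := sin_sq_add_cos_sq r₂
  have q₁ : sinc r₁ ^ 2 * (x₁ ^ 2 + y₁ ^ 2) = sin r₁ ^ 2 := by rw [← h₁, ← mul_pow, e₁]
  have q₂ : sinc r₂ ^ 2 * (x₂ ^ 2 + y₂ ^ 2) = sin r₂ ^ 2 := by rw [← h₂, ← mul_pow, e₂]
  have q : sinc r₁ * sinc r₂ * (r₁ * r₂) = sin r₁ * sin r₂ := by rw [← e₁, ← e₂]; ring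
  rw [cos_sub] at c₁
  rw [cos_sub] at c₃
  have z₁' : cos r₁ ^ 2 * (cos z₁ ^ 2 + sin z₁ ^ 2) = cos r₁ ^ 2 := by simp
  have z₂' : cos r₂ ^ 2 * (cos z₂ ^ 2 + sin z₂ ^ 2) = cos r₂ ^ 2 := by simp
  linarith

theorem exists_lipschitz_of_contDiffOn {f : ℝ → ℝ} {a b : ℝ} (hab : a < b)
    (hf : ContDiffOn ℝ 1 f (Icc a b)) :
    ∃ K, 0 ≤ K ∧ ∀ x ∈ Icc a b, ∀ y ∈ Icc a b, |f y - f x| ≤ K * |y - x| := by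
  have hc := hf.continuousOn_derivWithin (uniqueDiffOn_Icc hab) le_rfl
  obtain ⟨K, hK⟩ := isCompact_Icc.exists_bound_of_continuousOn hc
  refine ⟨max K 0, le_max_right _ _, fun x hx y hy ↦ ?_⟩
  exact (convex_Icc a b).norm_image_sub_le_of_norm_derivWithin_le
    (hf.differentiableOn one_ne_zero) (fun z hz ↦ (hK z hz).trans (le_max_left _ _)) hx hy

theorem exists_lipschitzOn_of_piecewise {f : ℝ → ℝ} (t : ℕ → ℝ) (n : ℕ)
    (ht : ∀ i < n, t i < t (i + 1))
    (hf : ∀ i < n, ContDiffOn ℝ 1 f (Icc (t i) (t (i + 1)))) :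
    t 0 ≤ t n ∧ ∃ K, 0 ≤ K ∧ ∀ x y, t 0 ≤ x → x ≤ y → y ≤ t n → |f y - f x| ≤ K * (y - x) := by
  induction n with
  | zero =>
    refine ⟨le_rfl, 0, le_rfl, fun x y h₁ h₂ h₃ ↦ ?_⟩
    obtain rfl : x = y := by linarith
    simp
  | succ n ih =>
    obtain ⟨h₀, K, hK₀, hK⟩ := ih (fun i hi ↦ ht i (by omega)) (fun i hi ↦ hf i (by omega))
    have hn := ht n (by omega)
    obtain ⟨L, hL₀, hL⟩ := exists_lipschitz_of_contDiffOn hn (hf n (by omega))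
    refine ⟨h₀.trans hn.le, K + L, by positivity, fun x y h₁ h₂ h₃ ↦ ?_⟩
    rcases le_total y (t n) with hy | hy
    · have := hK x y h₁ h₂ hy
      nlinarith
    rcases le_total x (t n) with hx | hx
    · have u := hK x (t n) h₁ hx le_rfl
      have v := hL (t n) ⟨le_rfl, hn.le⟩ y ⟨hy, h₃⟩
      rw [abs_of_nonneg (sub_nonneg.2 hy)] at v
      have := abs_sub_le (f y) (f (t n)) (f x)
      nlinarith
    · have v := hL x ⟨hx, h₂.trans h₃⟩ y ⟨hy, h₃⟩
      rw [abs_of_nonneg (sub_nonneg.2 h₂)] at v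
      nlinarith

open InnerProductGeometry in
theorem norm_sub_eq_two_mul_sin_angle_div_two {E : Type*} [NormedAddCommGroup E]
    [InnerProductSpace ℝ E] {x y : E} (hx : ‖x‖ = 1) (hy : ‖y‖ = 1) :
    ‖x - y‖ = 2 * sin (angle x y / 2) := by
  have h :=
    norm_sub_sq_eq_norm_sq_add_norm_sq_sub_two_mul_norm_mul_norm_mul_cos_angle x y
  have h₁ := angle_nonneg x y
  have h₂ := angle_le_pi x y
  have hs : 0 ≤ sin (angle x y / 2) :=
    sin_nonneg_of_nonneg_of_le_pi (by linarith) (by linarith)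
  rw [hx, hy] at h
  have hc : cos (angle x y) = 1 - 2 * sin (angle x y / 2) ^ 2 := by
    have := cos_two_mul (angle x y / 2)
    rw [mul_div_cancel₀ _ two_ne_zero] at this
    nlinarith [sin_sq_add_cos_sq (angle x y / 2)]
  rw [hc] at h
  exact (sq_eq_sq₀ (norm_nonneg _) (by positivity)).1 (by nlinarith)

open InnerProductGeometry in
theorem angle_le_pi_div_two_mul_norm_sub {E : Type*} [NormedAddCommGroup E]
    [InnerProductSpace ℝ E] {x y : E} (hx : ‖x‖ = 1) (hy : ‖y‖ = 1) :
    angle x y ≤ π / 2 * ‖x - y‖ := by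
  have h := mul_le_sin (x := angle x y / 2) (by linarith [angle_nonneg x y])
    (by linarith [angle_le_pi x y])
  rw [norm_sub_eq_two_mul_sin_angle_div_two hx hy]
  calc angle x y = π / 2 * (2 * (2 / π * (angle x y / 2))) := by field_simp
    _ ≤ _ := by gcongr

open InnerProductGeometry in
theorem angle_eq_two_mul_arcsin {E : Type*} [NormedAddCommGroup E]
    [InnerProductSpace ℝ E] {x y : E} (hx : ‖x‖ = 1) (hy : ‖y‖ = 1) :
    angle x y = 2 * arcsin (‖x - y‖ / 2) := by
  rw [norm_sub_eq_two_mul_sin_angle_div_two hx hy, mul_div_cancel_left₀ _ two_ne_zero,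
    arcsin_sin (by linarith [angle_nonneg x y, pi_pos]) (by linarith [angle_le_pi x y])]
  ring

open InnerProductGeometry in
/-- A Lipschitz curve on the unit sphere joining antipodal points has length at least `π`, the
length being measured by any upper bound `w` of its metric speed. -/
theorem pi_le_integral_of_antipodal {E : Type*} [NormedAddCommGroup E] [InnerProductSpace ℝ E]
    {ψ : ℝ → E} {w : ℝ → ℝ} {K : ℝ} (hn : ∀ t, ‖ψ t‖ = 1) (hK : 0 ≤ K)
    (hL : ∀ x ∈ Icc (0 : ℝ) 1, ∀ y ∈ Icc (0 : ℝ) 1, ‖ψ y - ψ x‖ ≤ K * |y - x|)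
    (hend : ψ 1 = -ψ 0) (hw : IntervalIntegrable w volume 0 1)
    (hd : ∀ᵐ t : ℝ, t ∈ Ioo (0 : ℝ) 1 → ∃ (d : ℝ → ℝ) (c : ℝ),
      (∀ᶠ s in 𝓝[>] t, ‖ψ s - ψ t‖ ≤ d s) ∧ d t = 0 ∧ HasDerivWithinAt d c (Ioi t) t ∧ c ≤ w t) :
    π ≤ ∫ t in (0 : ℝ)..1, w t := by
  set G : ℝ → ℝ := fun t ↦ angle (ψ 0) (ψ t)
  have hψ : ∀ t, ψ t ≠ 0 := fun t h ↦ by simpa [h] using hn t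
  have hG : ∀ x y, G y - G x ≤ angle (ψ y) (ψ x) := fun x y ↦ by
    have := angle_le_angle_add_angle (ψ 0) (ψ x) (ψ y)
    rw [angle_comm (ψ x)] at this
    simp only [G]; linarith
  have hlip : LipschitzOnWith (π / 2 * K).toNNReal G (uIcc 0 1) := by
    rw [uIcc_of_le zero_le_one]
    refine LipschitzOnWith.of_le_add_mul _ fun x hx y hy ↦ ?_
    rw [Real.coe_toNNReal _ (by positivity), Real.dist_eq]
    have h₁ := hG y x
    have h₂ := angle_le_pi_div_two_mul_norm_sub (hn x) (hn y)
    have h₃ := mul_le_mul_of_nonneg_left (hL y hy x hx) (by positivity : 0 ≤ π / 2)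
    linarith
  have hac := hlip.absolutelyContinuousOnInterval
  have h0 : G 0 = 0 := angle_self (hψ 0)
  have h1 : G 1 = π := by simp only [G]; rw [hend, angle_self_neg_of_nonzero (hψ 0)]
  have hint := hac.integral_deriv_eq_sub
  rw [h0, h1, sub_zero] at hint
  rw [← hint]
  refine intervalIntegral.integral_mono_ae_restrict zero_le_one hac.intervalIntegrable_deriv hw ?_
  rw [← Measure.restrict_congr_set Ioo_ae_eq_Icc]
  rw [uIcc_of_le zero_le_one] at hlip
  rw [EventuallyLE, ae_restrict_iff' measurableSet_Ioo]
  filter_upwards [hlip.ae_differentiableWithinAt_of_mem_real, hd] with t hdiff hdt ht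
  obtain ⟨d, c, hle, hd0, hder, hc⟩ := hdt ht
  have hGd : HasDerivWithinAt G (deriv G t) (Ioi t) t :=
    ((hdiff (Ioo_subset_Icc_self ht)).differentiableAt
      (Icc_mem_nhds ht.1 ht.2)).hasDerivAt.hasDerivWithinAt
  have hA : HasDerivWithinAt (fun s ↦ 2 * arcsin (d s / 2)) c (Ioi t) t := by
    have h : HasDerivAt arcsin 1 (d t / 2) := by
      rw [hd0, zero_div]
      simpa using hasDerivAt_arcsin (x := 0) (by norm_num) (by norm_num)
    have := (h.comp_hasDerivWithinAt t (hder.div_const 2)).const_mul 2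
    rwa [one_mul, mul_div_cancel₀ _ two_ne_zero] at this
  rw [hasDerivWithinAt_iff_tendsto_slope' self_notMem_Ioi] at hGd hA
  refine (le_of_tendsto_of_tendsto hGd hA ?_).trans hc
  filter_upwards [hle, self_mem_nhdsWithin] with s hs hst
  rw [slope_def_field, slope_def_field, hd0, zero_div, arcsin_zero, mul_zero, sub_zero]
  have : 0 < s - t := sub_pos.2 hst
  gcongr
  refine (hG t s).trans ?_
  rw [angle_eq_two_mul_arcsin (hn s) (hn t)]
  have := monotone_arcsin (show ‖ψ s - ψ t‖ / 2 ≤ d s / 2 by linarith)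
  linarith

theorem hasDerivWithinAt_sqrt_sum_sq {f g h c : ℝ → ℝ} {f' g' h' t : ℝ} (hf : HasDerivAt f f' t)
    (hg : HasDerivAt g g' t) (hh : HasDerivAt h h' t) (hc : ContinuousAt c t) :
    HasDerivWithinAt (fun s ↦ √((f s - f t) ^ 2 + (g s - g t) ^ 2 + c s * (h s - h t) ^ 2))
      (√(f' ^ 2 + g' ^ 2 + c t * h' ^ 2)) (Ioi t) t := by
  have hf := hf.hasDerivWithinAt (s := Ioi t)
  have hg := hg.hasDerivWithinAt (s := Ioi t)
  have hh := hh.hasDerivWithinAt (s := Ioi t)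
  rw [hasDerivWithinAt_iff_tendsto_slope' self_notMem_Ioi] at hf hg hh ⊢
  have key := (((hf.pow 2).add (hg.pow 2)).add
    ((hc.tendsto.mono_left nhdsWithin_le_nhds).mul (hh.pow 2))).sqrt
  refine key.congr' ?_
  filter_upwards [self_mem_nhdsWithin] with s hs
  have hst : 0 < s - t := sub_pos.2 hs
  simp only [slope_def_field, sub_self, ne_eq, OfNat.ofNat_ne_zero, not_false_eq_true, zero_pow,
    add_zero, mul_zero, sqrt_zero, sub_zero]
  rw [eq_div_iff hst.ne', ← sqrt_sq hst.le, sqrt_sq hst.le, mul_comm]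
  nth_rw 1 [← sqrt_sq hst.le]
  rw [← sqrt_mul (sq_nonneg _)]
  congr 1
  field_simp

theorem PC1.exists_lipschitz {f : ℝ → ℝ} (hf : PC1 f) :
    ∃ K, 0 ≤ K ∧ ∀ x ∈ Icc (0 : ℝ) 1, ∀ y ∈ Icc (0 : ℝ) 1, |f y - f x| ≤ K * |y - x| := by
  obtain ⟨n, t, h0, h1, ht, -, hf⟩ := hf
  obtain ⟨-, K, hK, h⟩ := exists_lipschitzOn_of_piecewise t n ht hf
  rw [h0, h1] at h
  refine ⟨K, hK, fun x hx y hy ↦ ?_⟩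
  rcases le_total x y with hxy | hxy
  · rw [abs_of_nonneg (sub_nonneg.2 hxy)]
    exact h x y hx.1 hxy hy.2
  · rw [abs_sub_comm, abs_sub_comm y, abs_of_nonneg (sub_nonneg.2 hxy)]
    exact h y x hy.1 hxy hx.2

theorem PC1.lipschitzOnWith {f : ℝ → ℝ} (hf : PC1 f) : ∃ K, LipschitzOnWith K f (Icc 0 1) := by
  obtain ⟨K, hK, h⟩ := hf.exists_lipschitz
  refine ⟨K.toNNReal, LipschitzOnWith.of_dist_le_mul fun x hx y hy ↦ ?_⟩
  rw [Real.coe_toNNReal _ hK, dist_eq, dist_eq]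
  exact h y hy x hx

theorem PC1.ae_hasDerivAt {f : ℝ → ℝ} (hf : PC1 f) :
    ∀ᵐ t : ℝ, t ∈ Ioo (0 : ℝ) 1 → HasDerivAt f (deriv f t) t := by
  obtain ⟨K, h⟩ := hf.lipschitzOnWith
  filter_upwards [h.ae_differentiableWithinAt_of_mem_real] with t hdiff ht
  exact ((hdiff (Ioo_subset_Icc_self ht)).differentiableAt (Icc_mem_nhds ht.1 ht.2)).hasDerivAt

theorem PC1.exists_abs_deriv_le {f : ℝ → ℝ} (hf : PC1 f) :
    ∃ K : ℝ, ∀ t ∈ Ioo (0 : ℝ) 1, |deriv f t| ≤ K := by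
  obtain ⟨K, h⟩ := hf.lipschitzOnWith
  exact ⟨K, fun t ht ↦ norm_deriv_le_of_lipschitzOn (Icc_mem_nhds ht.1 ht.2) h⟩

theorem infDist_ΔsqE_le {a : ℝ} (ha : 0 < a) (x y : ℝ) :
    Metric.infDist (pt2 x y) (ΔsqE a) ≤ √(fold a x ^ 2 + fold a y ^ 2) := by
  obtain ⟨m, hm⟩ := exists_abs_sub_two_mul_eq_fold ha x
  obtain ⟨n, hn⟩ := exists_abs_sub_two_mul_eq_fold ha y
  refine (Metric.infDist_le_dist_of_mem (show pt2 (2 * a * m) (2 * a * n) ∈ ΔsqE a from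
    ⟨m, n, rfl⟩)).trans ?_
  rw [EuclideanSpace.dist_eq, ← sq_abs (fold a x), ← sq_abs (fold a y), ← hm, ← hn]
  simp [pt2, Real.dist_eq, sq_abs]

theorem intervalIntegrable_speed {γ₁ γ₂ γ₃ : ℝ → ℝ} (h₁ : PC1 γ₁) (h₂ : PC1 γ₂) (h₃ : PC1 γ₃)
    (Δ : Set (EuclideanSpace ℝ (Fin 2))) :
    IntervalIntegrable (fun t ↦ √(deriv γ₁ t ^ 2 + deriv γ₂ t ^ 2 +
      cos (Metric.infDist (pt2 (γ₁ t) (γ₂ t)) Δ) ^ 2 * deriv γ₃ t ^ 2)) volume 0 1 := by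
  have hc₁ : ContinuousOn γ₁ (Ioo 0 1) := by
    obtain ⟨K, h⟩ := h₁.lipschitzOnWith
    exact h.continuousOn.mono Ioo_subset_Icc_self
  have hc₂ : ContinuousOn γ₂ (Ioo 0 1) := by
    obtain ⟨K, h⟩ := h₂.lipschitzOnWith
    exact h.continuousOn.mono Ioo_subset_Icc_self
  have hp : ContinuousOn (fun t ↦ pt2 (γ₁ t) (γ₂ t)) (Ioo 0 1) := by
    unfold pt2
    refine (PiLp.continuous_toLp 2 _).comp_continuousOn (continuousOn_pi.2 fun i ↦ ?_)
    fin_cases i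
    · simpa using hc₁
    · simpa using hc₂
  have hcos : ContinuousOn (fun t ↦ cos (Metric.infDist (pt2 (γ₁ t) (γ₂ t)) Δ)) (Ioo 0 1) :=
    continuous_cos.comp_continuousOn ((Metric.continuous_infDist_pt Δ).comp_continuousOn hp)
  obtain ⟨K₁, hK₁⟩ := h₁.exists_abs_deriv_le
  obtain ⟨K₂, hK₂⟩ := h₂.exists_abs_deriv_le
  obtain ⟨K₃, hK₃⟩ := h₃.exists_abs_deriv_le
  rw [intervalIntegrable_iff_integrableOn_Ioo_of_le zero_le_one]
  have hfin : volume (Ioo (0 : ℝ) 1) < ⊤ := by simp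
  refine IntegrableOn.of_bound hfin ?_ (√(K₁ ^ 2 + K₂ ^ 2 + 1 * K₃ ^ 2)) ?_
  · refine continuous_sqrt.comp_aestronglyMeasurable (AEStronglyMeasurable.add ?_ ?_)
    · exact (((measurable_deriv γ₁).pow_const 2).add
        ((measurable_deriv γ₂).pow_const 2)).aestronglyMeasurable
    · exact ((hcos.pow 2).aestronglyMeasurable measurableSet_Ioo).mul
        ((measurable_deriv γ₃).pow_const 2).aestronglyMeasurable
  · rw [ae_restrict_iff' measurableSet_Ioo]
    refine ae_of_all _ fun t ht ↦ ?_
    rw [norm_of_nonneg (sqrt_nonneg _)]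
    refine sqrt_le_sqrt (add_le_add (add_le_add ?_ ?_) (mul_le_mul (cos_sq_le_one _) ?_
      (sq_nonneg _) zero_le_one))
    · exact sq_le_sq.2 ((hK₁ t ht).trans (le_abs_self _))
    · exact sq_le_sq.2 ((hK₂ t ht).trans (le_abs_self _))
    · exact sq_le_sq.2 ((hK₃ t ht).trans (le_abs_self _))

/-- The distance to the lattice vertex `0` after folding the plane onto the Voronoi cell. -/
def foldRadius (a x y : ℝ) : ℝ := √(fold a x ^ 2 + fold a y ^ 2)

/-- The length-nonincreasing map from `ℝ³` with the singular metric to the unit sphere of `ℝ⁴`. -/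
def toSphere (a x y z : ℝ) : EuclideanSpace ℝ (Fin 4) :=
  !₂[cos (foldRadius a x y) * cos z, cos (foldRadius a x y) * sin z,
    sinc (foldRadius a x y) * fold a x, sinc (foldRadius a x y) * fold a y]

theorem norm_toSphere (a x y z : ℝ) : ‖toSphere a x y z‖ = 1 := by
  have hr : foldRadius a x y ^ 2 = fold a x ^ 2 + fold a y ^ 2 := sq_sqrt (by positivity)
  have h := sinc_mul_self (foldRadius a x y)
  rw [EuclideanSpace.norm_eq, sqrt_eq_one]
  simp only [toSphere, Fin.sum_univ_four, norm_eq_abs, sq_abs]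
  simp only [Matrix.cons_val]
  calc _ = cos (foldRadius a x y) ^ 2 * (sin z ^ 2 + cos z ^ 2) +
        (sinc (foldRadius a x y)) ^ 2 * (fold a x ^ 2 + fold a y ^ 2) := by ring
    _ = 1 := by rw [← hr, ← mul_pow, h, sin_sq_add_cos_sq, mul_one, cos_sq_add_sin_sq]

theorem foldRadius_le {a : ℝ} (ha : 0 < a) (ha' : a < π / (2 * √2)) (x y : ℝ) :
    foldRadius a x y ≤ π / 2 := by
  have hx : fold a x ^ 2 ≤ a ^ 2 := sq_le_sq.2 ((abs_fold_le ha x).trans (le_abs_self a))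
  have hy : fold a y ^ 2 ≤ a ^ 2 := sq_le_sq.2 ((abs_fold_le ha y).trans (le_abs_self a))
  have h2 : (√2) ^ 2 = 2 := sq_sqrt zero_le_two
  rw [lt_div_iff₀ (by positivity)] at ha'
  refine sqrt_le_iff.2 ⟨by positivity, ?_⟩
  have : (a * √2) ^ 2 ≤ (π / 2) ^ 2 := pow_le_pow_left₀ (by positivity) (by linarith) 2
  rw [mul_pow, h2] at this
  linarith

theorem cos_foldRadius_nonneg {a : ℝ} (ha : 0 < a) (ha' : a < π / (2 * √2)) (x y : ℝ) :
    0 ≤ cos (foldRadius a x y) :=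
  cos_nonneg_of_neg_pi_div_two_le_of_le
    (by linarith [pi_pos, show 0 ≤ foldRadius a x y from sqrt_nonneg _]) (foldRadius_le ha ha' x y)

theorem norm_toSphere_sub_le {a : ℝ} (ha : 0 < a) (ha' : a < π / (2 * √2))
    (x₁ y₁ z₁ x₂ y₂ z₂ : ℝ) :
    ‖toSphere a x₁ y₁ z₁ - toSphere a x₂ y₂ z₂‖ ≤ √((x₁ - x₂) ^ 2 + (y₁ - y₂) ^ 2 +
      cos (foldRadius a x₁ y₁) * cos (foldRadius a x₂ y₂) * (z₁ - z₂) ^ 2) := by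
  rw [EuclideanSpace.norm_eq]
  refine sqrt_le_sqrt ?_
  simp only [toSphere, Fin.sum_univ_four, norm_eq_abs, sq_abs, PiLp.sub_apply]
  simp only [Matrix.cons_val]
  refine (chord_sq_le z₁ z₂ (sqrt_nonneg _) (sqrt_nonneg _) (sq_sqrt (by positivity))
    (sq_sqrt (by positivity)) (mul_nonneg (cos_foldRadius_nonneg ha ha' x₁ y₁)
      (cos_foldRadius_nonneg ha ha' x₂ y₂))).trans ?_
  gcongr ?_ + ?_ + _
  · exact sq_le_sq.2 (abs_fold_sub_le ha _ _)
  · exact sq_le_sq.2 (abs_fold_sub_le ha _ _)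

theorem toSphere_sigma0_add {a : ℝ} (ha : 0 < a) (x y z : ℝ) (k₁ k₂ k₃ : ℤ) :
    toSphere a (-x + 4 * a * k₁) (-y + 4 * a * k₂) (z + π + 2 * π * k₃) = -toSphere a x y z := by
  have hr : foldRadius a (-x + 4 * a * k₁) (-y + 4 * a * k₂) = foldRadius a x y := by
    rw [foldRadius, fold_neg_add ha, fold_neg_add ha, neg_sq, neg_sq, foldRadius]
  have hz : z + π + 2 * π * k₃ = z + π + k₃ * (2 * π) := by ring
  ext i
  simp only [toSphere, hr, fold_neg_add ha, hz, cos_add_int_mul_two_pi, sin_add_int_mul_two_pi,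
    cos_add_pi, sin_add_pi]
  fin_cases i <;> simp

theorem continuous_fold {a : ℝ} : Continuous (fold a) := by
  unfold fold; fun_prop

theorem cos_foldRadius_le {a : ℝ} (ha : 0 < a) (ha' : a < π / (2 * √2)) (x y : ℝ) :
    cos (foldRadius a x y) ≤ cos (Metric.infDist (pt2 x y) (ΔsqE a)) :=
  cos_le_cos_of_nonneg_of_le_pi Metric.infDist_nonneg
    (by linarith [foldRadius_le ha ha' x y, pi_pos]) (infDist_ΔsqE_le ha x y)

/-- for `0 < a < π/(2√2)`, `Δ = Δ_sq(a)`, `Λ = 4aℤ × 4aℤ × 2πℤ`, every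
piecewise `C¹` curve from `m` to `σ₀(m) + v` (`v ∈ Λ`) has `L_Δ`-length at least `π`;
i.e. in the singular torus `(T, g_c)` one has `dist(m, σ(m)) ≥ π` for all `m`. -/
theorem distance_to_sigma_orbit_square (a : ℝ) (ha : 0 < a)
    (ha' : a < π / (2 * Real.sqrt 2))
    (v : ℝ × ℝ × ℝ) (hv : v ∈ Λsq3 a)
    (γ₁ γ₂ γ₃ : ℝ → ℝ) (h₁ : PC1 γ₁) (h₂ : PC1 γ₂) (h₃ : PC1 γ₃)
    (hend : (γ₁ 1, γ₂ 1, γ₃ 1) = sigma0 (γ₁ 0, γ₂ 0, γ₃ 0) + v) :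
    π ≤ sLen (ΔsqE a) γ₁ γ₂ γ₃ := by
  obtain ⟨k₁, k₂, k₃, rfl⟩ := hv
  simp only [sigma0, Prod.mk_add_mk, Prod.mk.injEq] at hend
  obtain ⟨e₁, e₂, e₃⟩ := hend
  obtain ⟨K₁, hK₁, hL₁⟩ := h₁.exists_lipschitz
  obtain ⟨K₂, hK₂, hL₂⟩ := h₂.exists_lipschitz
  obtain ⟨K₃, hK₃, hL₃⟩ := h₃.exists_lipschitz
  refine pi_le_integral_of_antipodal (ψ := fun t ↦ toSphere a (γ₁ t) (γ₂ t) (γ₃ t))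
    (K := √(K₁ ^ 2 + K₂ ^ 2 + 1 * K₃ ^ 2)) (fun t ↦ norm_toSphere _ _ _ _) (sqrt_nonneg _) ?_ ?_
    (intervalIntegrable_speed h₁ h₂ h₃ (ΔsqE a)) ?_
  · intro x hx y hy
    refine (norm_toSphere_sub_le ha ha' _ _ _ _ _ _).trans ?_
    rw [← sqrt_sq (abs_nonneg (y - x)), ← sqrt_mul (by positivity), add_mul, add_mul, mul_assoc 1,
      ← mul_pow, ← mul_pow, ← mul_pow]
    refine sqrt_le_sqrt (add_le_add (add_le_add ?_ ?_) (mul_le_mul ?_ ?_ (sq_nonneg _) zero_le_one))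
    · exact sq_le_sq.2 ((hL₁ x hx y hy).trans (le_abs_self _))
    · exact sq_le_sq.2 ((hL₂ x hx y hy).trans (le_abs_self _))
    · exact mul_le_one₀ (cos_le_one _) (cos_foldRadius_nonneg ha ha' _ _) (cos_le_one _)
    · exact sq_le_sq.2 ((hL₃ x hx y hy).trans (le_abs_self _))
  · simp only [e₁, e₂, e₃]
    exact toSphere_sigma0_add ha _ _ _ _ _ _
  · filter_upwards [h₁.ae_hasDerivAt, h₂.ae_hasDerivAt, h₃.ae_hasDerivAt] with t d₁ d₂ d₃ ht
    have hc : ContinuousAt (fun s ↦ cos (foldRadius a (γ₁ s) (γ₂ s)) *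
        cos (foldRadius a (γ₁ t) (γ₂ t))) t := by
      have c₁ := (continuous_fold (a := a)).continuousAt.comp (d₁ ht).continuousAt
      have c₂ := (continuous_fold (a := a)).continuousAt.comp (d₂ ht).continuousAt
      exact (continuous_cos.continuousAt.comp ((c₁.pow 2).add (c₂.pow 2)).sqrt).mul
        continuousAt_const
    refine ⟨_, _, Eventually.of_forall fun s ↦ norm_toSphere_sub_le ha ha' _ _ _ _ _ _, by simp,
      hasDerivWithinAt_sqrt_sum_sq (d₁ ht) (d₂ ht) (d₃ ht) hc, ?_⟩
    refine sqrt_le_sqrt ?_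
    rw [← sq]
    gcongr
    · exact cos_foldRadius_nonneg ha ha' _ _
    · exact cos_foldRadius_le ha ha' _ _

end
end
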